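/- For every classical solution of system (S), the energy E is differentiable on [0,∞) and for every t ≥ 0 one has E'(t) = −∫₀¹ q(x) u_t(t,x)² dx − (a(1)α₁/β₁) η₁(t)² − (a(0)γ₁/μ₁) ζ₁(t)². In particular E is non-increasing. -/

import Mathlib

open Set MeasureTheory

/-- A classical solution of system (S): a wave equation with localized in-domain damping and
Wentzell (dynamic) boundary conditions. -/
structure ClassicalSolutionS (a q : ℝ → ℝ) (α₁ α₂ β₁ γ₁ μ₁ : ℝ) where
  u : ℝ → ℝ → ℝ
  ut : ℝ → ℝ → ℝ
  ux : ℝ → ℝ → ℝ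
  utt : ℝ → ℝ → ℝ
  dAux : ℝ → ℝ → ℝ
  η₁ : ℝ → ℝ
  η₂ : ℝ → ℝ
  ζ₁ : ℝ → ℝ
  hu_t : ∀ t ∈ Ici (0:ℝ), ∀ x ∈ Icc (0:ℝ) 1, HasDerivAt (fun s => u s x) (ut t x) t
  hu_x : ∀ t ∈ Ici (0:ℝ), ∀ x ∈ Icc (0:ℝ) 1, HasDerivAt (fun y => u t y) (ux t x) x
  hut_C1 : ContDiffOn ℝ 1 (fun p : ℝ × ℝ => ut p.1 p.2) (Ici (0:ℝ) ×ˢ Icc (0:ℝ) 1)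
  hux_C1 : ContDiffOn ℝ 1 (fun p : ℝ × ℝ => ux p.1 p.2) (Ici (0:ℝ) ×ˢ Icc (0:ℝ) 1)
  hu_tt : ∀ t ∈ Ici (0:ℝ), ∀ x ∈ Icc (0:ℝ) 1, HasDerivAt (fun s => ut s x) (utt t x) t
  haux_lip : ∀ t ∈ Ici (0:ℝ),
      ∃ K : NNReal, LipschitzOnWith K (fun x => a x * ux t x) (Icc (0:ℝ) 1)
  haux : ∀ t ∈ Ici (0:ℝ), ∀ᵐ x ∂(volume.restrict (Ioo (0:ℝ) 1)),
      HasDerivAt (fun y => a y * ux t y) (dAux t x) x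
  hPDE : ∀ t ∈ Ici (0:ℝ), ∀ᵐ x ∂(volume.restrict (Ioo (0:ℝ) 1)),
      utt t x - dAux t x = - q x * ut t x
  hbc1 : ∀ t ∈ Ici (0:ℝ), ut t 1 = η₁ t
  hbc0 : ∀ t ∈ Ici (0:ℝ), ut t 0 = ζ₁ t
  hη₁C1 : ContDiffOn ℝ 1 η₁ (Ici (0:ℝ))
  hη₂C1 : ContDiffOn ℝ 1 η₂ (Ici (0:ℝ))
  hζ₁C1 : ContDiffOn ℝ 1 ζ₁ (Ici (0:ℝ))
  hode1 : ∀ t ∈ Ici (0:ℝ), HasDerivAt η₁ (-α₁ * η₁ t - α₂ * η₂ t - β₁ * ux t 1) t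
  hode2 : ∀ t ∈ Ici (0:ℝ), HasDerivAt η₂ (η₁ t) t
  hode3 : ∀ t ∈ Ici (0:ℝ), HasDerivAt ζ₁ (-γ₁ * ζ₁ t + μ₁ * ux t 0) t

/-- The energy of a classical solution of system (S). -/
noncomputable def energyS {a q : ℝ → ℝ} {α₁ α₂ β₁ γ₁ μ₁ : ℝ}
    (sol : ClassicalSolutionS a q α₁ α₂ β₁ γ₁ μ₁) (t : ℝ) : ℝ :=
  (1/2) * (∫ x in (0:ℝ)..1, (sol.ut t x ^ 2 + a x * sol.ux t x ^ 2))
    + (a 1 / (2 * β₁)) * sol.η₁ t ^ 2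
    + (a 1 * α₂ / (2 * β₁)) * sol.η₂ t ^ 2
    + (a 0 / (2 * μ₁)) * sol.ζ₁ t ^ 2

/-- Assumption (A1): `a` is Lipschitz on `[0,1]` and bounded below and above by positive
constants `a_min ≤ a_max`. -/
def AssumptionA1 (a : ℝ → ℝ) (a_min a_max : ℝ) : Prop :=
  (∃ K : NNReal, LipschitzOnWith K a (Icc (0:ℝ) 1)) ∧ 0 < a_min ∧ a_min ≤ a_max ∧
    ∀ x ∈ Icc (0:ℝ) 1, a_min ≤ a x ∧ a x ≤ a_max

/-- Assumption (A2): `q` is bounded measurable, nonnegative a.e., and bounded below by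
`q_min > 0` (and above by `q_max`) a.e. on a nonempty open subinterval `ω = (c,d) ⊆ (0,1)`. -/
def AssumptionA2 (q : ℝ → ℝ) (c d q_min q_max : ℝ) : Prop :=
  Measurable q ∧ (∃ Q : ℝ, ∀ x ∈ Icc (0:ℝ) 1, |q x| ≤ Q) ∧
    (∀ᵐ x ∂(volume.restrict (Ioo (0:ℝ) 1)), 0 ≤ q x) ∧
    0 ≤ c ∧ c < d ∧ d ≤ 1 ∧ 0 < q_min ∧ q_min ≤ q_max ∧
    ∀ᵐ x ∂(volume.restrict (Ioo c d)), q_min ≤ q x ∧ q x ≤ q_max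

section IntegralLemmas

open intervalIntegral

lemma ContinuousOn.exists_continuous_extension_quadrant {F : ℝ × ℝ → ℝ} {a b : ℝ} (hab : a ≤ b)
    (hF : ContinuousOn F (Ici (0:ℝ) ×ˢ Icc a b)) :
    ∃ G : ℝ × ℝ → ℝ, Continuous G ∧ EqOn F G (Ici (0:ℝ) ×ˢ Icc a b) := by
  refine ⟨fun p => F (max p.1 0, max a (min p.2 b)), ?_, ?_⟩
  · refine hF.comp_continuous (by fun_prop) fun p => ⟨?_, ?_, ?_⟩
    · exact le_max_right p.1 0
    · exact le_max_left a (min p.2 b)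
    · exact max_le hab (min_le_right p.2 b)
  · rintro ⟨t, x⟩ ⟨ht, hx⟩
    have h₁ : max t 0 = t := max_eq_left ht
    have h₂ : max a (min x b) = x := by rw [min_eq_left hx.2, max_eq_right hx.1]
    simp only [h₁, h₂]

/-- Differentiation under the integral sign on the closed half-line `[0, ∞)`. -/
lemma hasDerivWithinAt_integral_Ici {f f' : ℝ → ℝ → ℝ} {a b t₀ : ℝ} (hab : a ≤ b)
    (hf : ContinuousOn (f 0) (Icc a b))
    (hf' : ContinuousOn (fun p : ℝ × ℝ => f' p.1 p.2) (Ici (0:ℝ) ×ˢ Icc a b))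
    (hd : ∀ t ∈ Ici (0:ℝ), ∀ x ∈ Icc a b,
      HasDerivWithinAt (fun s => f s x) (f' t x) (Ici (0:ℝ)) t)
    (ht₀ : t₀ ∈ Ici (0:ℝ)) :
    HasDerivWithinAt (fun t => ∫ x in a..b, f t x) (∫ x in a..b, f' t₀ x) (Ici (0:ℝ)) t₀ := by
  obtain ⟨G, hG, hGeq⟩ := hf'.exists_continuous_extension_quadrant hab
  have hint : ∀ t ∈ Ici (0:ℝ), ∫ x in a..b, f' t x = ∫ x in a..b, G (t, x) := fun t ht =>
    integral_congr fun x hx => hGeq (x := (t, x)) ⟨ht, by rwa [uIcc_of_le hab] at hx⟩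
  have key : ∀ t ∈ Ici (0:ℝ),
      ∫ x in a..b, f t x = (∫ x in a..b, f 0 x) + ∫ s in (0:ℝ)..t, ∫ x in a..b, G (s, x) := by
    intro t ht
    have hpt : EqOn (f t) (fun x => f 0 x + ∫ s in (0:ℝ)..t, G (s, x)) (uIcc a b) := by
      intro x hx
      rw [uIcc_of_le hab] at hx
      have : ∫ s in (0:ℝ)..t, G (s, x) = f t x - f 0 x := by
        refine integral_eq_sub_of_hasDeriv_right_of_le ht
          (f := fun s => f s x)
          (fun s hs => ((hd s hs.1 x hx).continuousWithinAt).mono Icc_subset_Ici_self)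
          (fun s hs => ?_) ((by fun_prop : Continuous fun s => G (s, x)).intervalIntegrable _ _)
        rw [← hGeq (⟨hs.1.le, hx⟩ : (s, x) ∈ Ici (0:ℝ) ×ˢ Icc a b)]
        exact (hd s hs.1.le x hx).mono fun r hr => hs.1.le.trans (le_of_lt hr)
      simp only [this]; ring
    have hc : Continuous fun x => ∫ s in (0:ℝ)..t, G (s, x) :=
      continuous_parametric_intervalIntegral_of_continuous' (f := fun x s => G (s, x))
        (by simp only [Function.uncurry_def]; fun_prop) 0 t
    rw [integral_congr hpt, intervalIntegral.integral_add
      (hf.intervalIntegrable_of_Icc hab) (hc.intervalIntegrable _ _)]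
    congr 1
    exact intervalIntegral_intervalIntegral_swap (F := fun x s => G (s, x))
      ((by simp only [Function.uncurry_def]; fun_prop :
        Continuous (Function.uncurry fun x s => G (s, x))).continuousOn.integrableOn_compact
          (isCompact_uIcc.prod isCompact_uIcc) |>.mono_set
            (prod_mono uIoc_subset_uIcc uIoc_subset_uIcc))
  have hc : Continuous fun s => ∫ x in a..b, G (s, x) :=
    continuous_parametric_intervalIntegral_of_continuous' (f := fun s x => G (s, x))
      (by simp only [Function.uncurry_def]; fun_prop) a b
  rw [hint t₀ ht₀]
  exact (((hc.integral_hasStrictDerivAt 0 t₀).hasDerivAt.const_add _).hasDerivWithinAt).congr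
    key (key t₀ ht₀)

/-- A function that is `C¹` on `[0, ∞) × [0, 1]` has a continuous time derivative there. -/
lemma ContDiffOn.exists_continuousOn_hasDerivWithinAt_fst {F : ℝ → ℝ → ℝ}
    (hF : ContDiffOn ℝ 1 (fun p : ℝ × ℝ => F p.1 p.2) (Ici (0:ℝ) ×ˢ Icc (0:ℝ) 1)) :
    ∃ F' : ℝ → ℝ → ℝ,
      ContinuousOn (fun p : ℝ × ℝ => F' p.1 p.2) (Ici (0:ℝ) ×ˢ Icc (0:ℝ) 1) ∧
      ∀ t ∈ Ici (0:ℝ), ∀ x ∈ Icc (0:ℝ) 1,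
        HasDerivWithinAt (fun s => F s x) (F' t x) (Ici (0:ℝ)) t := by
  have hU : UniqueDiffOn ℝ (Ici (0:ℝ) ×ˢ Icc (0:ℝ) 1) :=
    (uniqueDiffOn_Ici 0).prod (uniqueDiffOn_Icc zero_lt_one)
  refine ⟨fun t x => fderivWithin ℝ (fun p : ℝ × ℝ => F p.1 p.2)
    (Ici (0:ℝ) ×ˢ Icc (0:ℝ) 1) (t, x) (1, 0), ?_, fun t ht x hx => ?_⟩
  · exact (hF.continuousOn_fderivWithin hU le_rfl).clm_apply continuousOn_const
  · have h := (hF.differentiableOn one_ne_zero (t, x) ⟨ht, hx⟩).hasFDerivWithinAt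
    have h₂ : HasDerivWithinAt (fun s : ℝ => (s, x)) ((1 : ℝ), (0 : ℝ)) (Ici (0:ℝ)) t :=
      (hasDerivWithinAt_id t _).prodMk (hasDerivWithinAt_const t _ x)
    exact h.comp_hasDerivWithinAt t h₂ fun s hs => mk_mem_prod hs hx

end IntegralLemmas

namespace ClassicalSolutionS

variable {a q : ℝ → ℝ} {α₁ α₂ β₁ γ₁ μ₁ : ℝ} (sol : ClassicalSolutionS a q α₁ α₂ β₁ γ₁ μ₁)

lemma continuousOn_ut_slice {t : ℝ} (ht : t ∈ Ici (0:ℝ)) :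
    ContinuousOn (sol.ut t) (Icc (0:ℝ) 1) :=
  sol.hut_C1.continuousOn.comp (f := fun x => (t, x)) (s := Icc (0:ℝ) 1) (by fun_prop)
    fun _ hx => ⟨ht, hx⟩

lemma continuousOn_ux_slice {t : ℝ} (ht : t ∈ Ici (0:ℝ)) :
    ContinuousOn (sol.ux t) (Icc (0:ℝ) 1) :=
  sol.hux_C1.continuousOn.comp (f := fun x => (t, x)) (s := Icc (0:ℝ) 1) (by fun_prop)
    fun _ hx => ⟨ht, hx⟩

lemma continuousOn_utt :
    ContinuousOn (fun p : ℝ × ℝ => sol.utt p.1 p.2) (Ici (0:ℝ) ×ˢ Icc (0:ℝ) 1) := by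
  obtain ⟨F', hF', hd⟩ := sol.hut_C1.exists_continuousOn_hasDerivWithinAt_fst
  exact hF'.congr fun p hp => (uniqueDiffOn_Ici (0:ℝ) p.1 hp.1).eq_deriv _
    (sol.hu_tt p.1 hp.1 p.2 hp.2).hasDerivWithinAt (hd p.1 hp.1 p.2 hp.2)

/-- Equality of mixed derivatives: the time derivative of `uₓ` is the space derivative of `uₜ`,
in integrated form. -/
lemma ut_eq_add_integral {uxt : ℝ → ℝ → ℝ}
    (hc : ContinuousOn (fun p : ℝ × ℝ => uxt p.1 p.2) (Ici (0:ℝ) ×ˢ Icc (0:ℝ) 1))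
    (hd : ∀ t ∈ Ici (0:ℝ), ∀ x ∈ Icc (0:ℝ) 1,
      HasDerivWithinAt (fun s => sol.ux s x) (uxt t x) (Ici (0:ℝ)) t)
    {t x : ℝ} (ht : t ∈ Ici (0:ℝ)) (hx : x ∈ Icc (0:ℝ) 1) :
    sol.ut t x = sol.ut t 0 + ∫ y in (0:ℝ)..x, uxt t y := by
  have hsub : Icc 0 x ⊆ Icc (0:ℝ) 1 := Icc_subset_Icc_right hx.2
  have h₀ : (0:ℝ) ∈ Icc (0:ℝ) 1 := ⟨le_rfl, zero_le_one⟩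
  have h₁ : HasDerivWithinAt (fun s => ∫ y in (0:ℝ)..x, sol.ux s y)
      (∫ y in (0:ℝ)..x, uxt t y) (Ici (0:ℝ)) t :=
    hasDerivWithinAt_integral_Ici hx.1
      ((sol.continuousOn_ux_slice self_mem_Ici).mono hsub)
      (hc.mono (prod_mono_right hsub)) (fun s hs y hy => hd s hs y (hsub hy)) ht
  have hftc : ∀ s ∈ Ici (0:ℝ), ∫ y in (0:ℝ)..x, sol.ux s y = sol.u s x - sol.u s 0 :=
    fun s hs => intervalIntegral.integral_eq_sub_of_hasDerivAt
      (fun y hy => sol.hu_x s hs y (hsub (by rwa [uIcc_of_le hx.1] at hy)))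
      (((sol.continuousOn_ux_slice hs).mono hsub).intervalIntegrable_of_Icc hx.1)
  have h₂ : HasDerivWithinAt (fun s => ∫ y in (0:ℝ)..x, sol.ux s y)
      (sol.ut t x - sol.ut t 0) (Ici (0:ℝ)) t :=
    ((sol.hu_t t ht x hx).sub (sol.hu_t t ht 0 h₀)).hasDerivWithinAt.congr hftc (hftc t ht)
  have := (uniqueDiffOn_Ici (0:ℝ) t ht).eq_deriv _ h₁ h₂
  linarith

lemma integral_ut_mul_dAux_add {uxt : ℝ → ℝ → ℝ}
    (hc : ContinuousOn (fun p : ℝ × ℝ => uxt p.1 p.2) (Ici (0:ℝ) ×ˢ Icc (0:ℝ) 1))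
    (hd : ∀ t ∈ Ici (0:ℝ), ∀ x ∈ Icc (0:ℝ) 1,
      HasDerivWithinAt (fun s => sol.ux s x) (uxt t x) (Ici (0:ℝ)) t)
    {t : ℝ} (ht : t ∈ Ici (0:ℝ)) :
    ∫ x in (0:ℝ)..1, (uxt t x * (a x * sol.ux t x) + sol.ut t x * sol.dAux t x)
      = sol.ut t 1 * (a 1 * sol.ux t 1) - sol.ut t 0 * (a 0 * sol.ux t 0) := by
  obtain ⟨G, hG, hGeq⟩ := hc.exists_continuous_extension_quadrant zero_le_one
  have hGt : Continuous fun y => G (t, y) := by fun_prop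
  set f : ℝ → ℝ := fun x => sol.ut t 0 + ∫ y in (0:ℝ)..x, G (t, y) with hf
  have hfd : ∀ x, HasDerivAt f (G (t, x)) x := fun x =>
    (hGt.integral_hasStrictDerivAt 0 x).hasDerivAt.const_add _
  have hfeq : EqOn (sol.ut t) f (Icc (0:ℝ) 1) := fun x hx => by
    rw [sol.ut_eq_add_integral hc hd ht hx, hf]
    congr 1
    refine intervalIntegral.integral_congr fun y hy => ?_
    rw [uIcc_of_le hx.1] at hy
    exact hGeq (x := (t, y)) ⟨ht, hy.1, hy.2.trans hx.2⟩
  have hfac : AbsolutelyContinuousOnInterval f 0 1 :=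
    ((LipschitzWith.const (sol.ut t 0)).lipschitzOnWith
      (s := uIcc (0:ℝ) 1)).absolutelyContinuousOnInterval.add
      ((hGt.intervalIntegrable 0 1).absolutelyContinuousOnInterval_intervalIntegral
        (c := 0) (by simp))
  obtain ⟨K, hK⟩ := sol.haux_lip t ht
  have hgac : AbsolutelyContinuousOnInterval (fun x => a x * sol.ux t x) 0 1 :=
    LipschitzOnWith.absolutelyContinuousOnInterval (K := K) (by rwa [uIcc_of_le zero_le_one])
  rw [hfeq ⟨zero_le_one, le_rfl⟩, hfeq ⟨le_rfl, zero_le_one⟩,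
    ← hfac.integral_deriv_mul_eq_sub hgac]
  simp only [intervalIntegral.integral_of_le (zero_le_one' ℝ), integral_Ioc_eq_integral_Ioo]
  refine integral_congr_ae ?_
  filter_upwards [sol.haux t ht, ae_restrict_mem measurableSet_Ioo] with x hx hmem
  have hmem' := Ioo_subset_Icc_self hmem
  rw [(hfd x).deriv, hx.deriv, hfeq hmem', ← hGeq ⟨ht, hmem'⟩]

lemma intervalIntegrable_q_mul_sq (hq : Measurable q) (hb : ∃ Q : ℝ, ∀ x ∈ Icc (0:ℝ) 1, |q x| ≤ Q)
    {t : ℝ} (ht : t ∈ Ici (0:ℝ)) :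
    IntervalIntegrable (fun x => q x * sol.ut t x ^ 2) volume 0 1 := by
  obtain ⟨Q, hQ⟩ := hb
  have hqi : IntervalIntegrable q volume 0 1 := by
    rw [intervalIntegrable_iff_integrableOn_Icc_of_le zero_le_one]
    exact Measure.integrableOn_of_bounded (by simp) hq.aestronglyMeasurable
      ((ae_restrict_iff' measurableSet_Icc).2 (.of_forall hQ))
  exact hqi.mul_continuousOn
    (by rw [uIcc_of_le zero_le_one]; exact (sol.continuousOn_ut_slice ht).pow 2)

/-- The rate of change of the part of the energy carried by the string. -/
lemma hasDerivWithinAt_integral_energyDensity (ha : ContinuousOn a (Icc (0:ℝ) 1))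
    (hq : Measurable q) (hb : ∃ Q : ℝ, ∀ x ∈ Icc (0:ℝ) 1, |q x| ≤ Q)
    {t : ℝ} (ht : t ∈ Ici (0:ℝ)) :
    HasDerivWithinAt (fun t => ∫ x in (0:ℝ)..1, (sol.ut t x ^ 2 + a x * sol.ux t x ^ 2))
      (2 * (sol.ut t 1 * (a 1 * sol.ux t 1) - sol.ut t 0 * (a 0 * sol.ux t 0))
        - 2 * ∫ x in (0:ℝ)..1, q x * sol.ut t x ^ 2) (Ici (0:ℝ)) t := by
  obtain ⟨uxt, hc, hd⟩ := sol.hux_C1.exists_continuousOn_hasDerivWithinAt_fst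
  have ha' : ContinuousOn (fun p : ℝ × ℝ => a p.2) (Ici (0:ℝ) ×ˢ Icc (0:ℝ) 1) :=
    ha.comp continuousOn_snd fun _ hp => hp.2
  set f' : ℝ → ℝ → ℝ := fun t x =>
    2 * (sol.ut t x * sol.utt t x) + a x * (2 * (sol.ux t x * uxt t x)) with hf'
  have hf'c : ContinuousOn (fun p : ℝ × ℝ => f' p.1 p.2) (Ici (0:ℝ) ×ˢ Icc (0:ℝ) 1) :=
    (continuousOn_const.mul (sol.hut_C1.continuousOn.mul sol.continuousOn_utt)).add
      (ha'.mul (continuousOn_const.mul (sol.hux_C1.continuousOn.mul hc)))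
  have hderiv := hasDerivWithinAt_integral_Ici (t₀ := t)
    (f := fun t x => sol.ut t x ^ 2 + a x * sol.ux t x ^ 2) (f' := f') zero_le_one
    (((sol.continuousOn_ut_slice self_mem_Ici).pow 2).add
      (ha.mul ((sol.continuousOn_ux_slice self_mem_Ici).pow 2))) hf'c
    (fun s hs x hx => by
      convert! (((sol.hu_tt s hs x hx).hasDerivWithinAt.pow 2).add
        (((hd s hs x hx).pow 2).const_mul (a x))) using 1
      simp only [hf']; push_cast; ring) ht
  convert hderiv using 1
  have hf't : IntervalIntegrable (f' t) volume 0 1 :=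
    (hf'c.comp (f := fun x => (t, x)) (by fun_prop)
      fun _ hx => ⟨ht, hx⟩).intervalIntegrable_of_Icc zero_le_one
  have hqi := sol.intervalIntegrable_q_mul_sq hq hb ht
  rw [sub_eq_iff_eq_add, ← sol.integral_ut_mul_dAux_add hc hd ht,
    ← intervalIntegral.integral_const_mul, ← intervalIntegral.integral_const_mul,
    ← intervalIntegral.integral_add hf't (hqi.const_mul 2)]
  simp only [intervalIntegral.integral_of_le (zero_le_one' ℝ), integral_Ioc_eq_integral_Ioo]
  refine integral_congr_ae ?_
  filter_upwards [sol.hPDE t ht] with x hx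
  have : sol.utt t x = sol.dAux t x - q x * sol.ut t x := by linarith
  simp only [hf', this]; ring

end ClassicalSolutionS

/-- Energy identity: along every classical solution of system (S), the energy is differentiable
on `[0,∞)` with `E'(t) = -∫₀¹ q uₜ² - (a(1)α₁/β₁) η₁² - (a(0)γ₁/μ₁) ζ₁²`; in particular `E` is
non-increasing on `[0,∞)`. -/
theorem energy_dissipation_S (a q : ℝ → ℝ) (a_min a_max c d q_min q_max α₁ α₂ β₁ γ₁ μ₁ : ℝ)
    (hA1 : AssumptionA1 a a_min a_max) (hA2 : AssumptionA2 q c d q_min q_max)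
    (hα₁ : 0 < α₁) (hα₂ : 0 < α₂) (hβ₁ : 0 < β₁) (hγ₁ : 0 < γ₁) (hμ₁ : 0 < μ₁)
    (sol : ClassicalSolutionS a q α₁ α₂ β₁ γ₁ μ₁) :
    (∀ t ∈ Ici (0:ℝ),
      HasDerivWithinAt (energyS sol)
        (-(∫ x in (0:ℝ)..1, q x * sol.ut t x ^ 2)
          - (a 1 * α₁ / β₁) * sol.η₁ t ^ 2 - (a 0 * γ₁ / μ₁) * sol.ζ₁ t ^ 2)
        (Ici (0:ℝ)) t) ∧
    AntitoneOn (energyS sol) (Ici (0:ℝ)) := by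
  obtain ⟨⟨K, hK⟩, hpos, -, hbd⟩ := hA1
  obtain ⟨hq, hb, hq0, -⟩ := hA2
  have hderiv : ∀ t ∈ Ici (0:ℝ), HasDerivWithinAt (energyS sol)
      (-(∫ x in (0:ℝ)..1, q x * sol.ut t x ^ 2)
        - (a 1 * α₁ / β₁) * sol.η₁ t ^ 2 - (a 0 * γ₁ / μ₁) * sol.ζ₁ t ^ 2) (Ici (0:ℝ)) t := by
    intro t ht
    have hI := sol.hasDerivWithinAt_integral_energyDensity hK.continuousOn hq hb ht
    rw [sol.hbc1 t ht, sol.hbc0 t ht] at hI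
    convert! (((hI.const_mul (1 / 2)).add
      (((sol.hode1 t ht).hasDerivWithinAt.pow 2).const_mul (a 1 / (2 * β₁)))).add
      (((sol.hode2 t ht).hasDerivWithinAt.pow 2).const_mul (a 1 * α₂ / (2 * β₁)))).add
      (((sol.hode3 t ht).hasDerivWithinAt.pow 2).const_mul (a 0 / (2 * μ₁))) using 1
    push_cast
    field_simp
    ring
  refine ⟨hderiv, antitoneOn_of_hasDerivWithinAt_nonpos (convex_Ici 0)
    (fun t ht => (hderiv t ht).continuousWithinAt)
    (fun t ht => (hderiv t (interior_subset ht)).mono interior_subset) fun t _ => ?_⟩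
  have h₀ : 0 ≤ ∫ x in (0:ℝ)..1, q x * sol.ut t x ^ 2 := by
    rw [intervalIntegral.integral_of_le zero_le_one, integral_Ioc_eq_integral_Ioo]
    exact integral_nonneg_of_ae (hq0.mono fun x hx => mul_nonneg hx (sq_nonneg _))
  have ha0 : 0 < a 0 := hpos.trans_le (hbd 0 ⟨le_rfl, zero_le_one⟩).1
  have ha1 : 0 < a 1 := hpos.trans_le (hbd 1 ⟨zero_le_one, le_rfl⟩).1
  have h₁ : 0 ≤ a 1 * α₁ / β₁ * sol.η₁ t ^ 2 := by positivity
  have h₂ : 0 ≤ a 0 * γ₁ / μ₁ * sol.ζ₁ t ^ 2 := by positivity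
  linarith
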